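/- arXiv:2305.15631 — 3 statements merged into one kernel-verified Lean document; each statement's English description precedes it below -/
import Mathlib

section
/- Let k ≥ 3 be an odd integer and n = ks with s ≥ 3. Let W ⊆ [n] with |W| = k+1 and U = [n] \ W, let f be an injective coloring of the k-subsets of U, and let A_1, …, A_N (N = (1/2)·binom(k+1,(k+1)/2)) be pairwise intersecting (k+1)/2-element subsets of W containing exactly one set from each complementary pair {A, W\A}. Color the complete k-graph K^k_n as follows: edges inside U get their f-color; an edge e with e ∩ W = A_i or e ∩ W = W \ A_i gets a new color c_i (distinct colors for distinct i, all distinct from the f-colors); every other edge gets one further color 0. Then this edge-coloring of K^k_n contains no rainbow perfect matching. -/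
open Finset

/-- A family of finsets is a matching if its members are pairwise disjoint. -/
def IsMatchingFam {α : Type*} [DecidableEq α] (M : Finset (Finset α)) : Prop :=
  (M : Set (Finset α)).Pairwise Disjoint

/-- The coloring of `K^k_n` (for odd `k`, `n = ks`) built from an injective coloring of the
`k`-subsets of `U = [n] \ W`, new colors `c i` on the edges meeting `W` exactly in `A i` or in
`W \ A i`, and one further color `z` on all remaining edges, has no rainbow perfect matching. -/
theorem no_rainbow_perfect_matching_odd (k s n : ℕ)
    (hk : 3 ≤ k) (hodd : Odd k) (hs : 3 ≤ s) (hn : n = k * s)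
    (W : Finset (Fin n)) (hW : W.card = k + 1)
    (N : ℕ) (hN : N = (k + 1).choose ((k + 1) / 2) / 2)
    (A : Fin N → Finset (Fin n)) (hAinj : Function.Injective A)
    (hAW : ∀ i, A i ⊆ W) (hAcard : ∀ i, (A i).card = (k + 1) / 2)
    (hAint : ∀ i j, (A i ∩ A j).Nonempty)
    (hApair : ∀ B ⊆ W, B.card = (k + 1) / 2 → ((∃ i, A i = B) ↔ ¬ ∃ i, A i = W \ B))
    (χ : Finset (Fin n) → ℕ) (c : Fin N → ℕ) (z : ℕ)
    (hinjU : Set.InjOn χ {e : Finset (Fin n) | e ⊆ Finset.univ \ W ∧ e.card = k})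
    (hcolA : ∀ i, ∀ e : Finset (Fin n), e.card = k →
        (e ∩ W = A i ∨ e ∩ W = W \ A i) → χ e = c i)
    (hcinj : Function.Injective c)
    (hcnew : ∀ i, ∀ e : Finset (Fin n), e ⊆ Finset.univ \ W → e.card = k → χ e ≠ c i)
    (hcolz : ∀ e : Finset (Fin n), e.card = k → ¬ e ⊆ Finset.univ \ W →
        (∀ i, e ∩ W ≠ A i ∧ e ∩ W ≠ W \ A i) → χ e = z)
    (hznew : ∀ e : Finset (Fin n), e ⊆ Finset.univ \ W → e.card = k → χ e ≠ z)
    (hzc : ∀ i, c i ≠ z) :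
    ¬ ∃ M : Finset (Finset (Fin n)), (∀ e ∈ M, e.card = k) ∧ IsMatchingFam M ∧
        (∀ v : Fin n, ∃ e ∈ M, v ∈ e) ∧ Set.InjOn χ ↑M := by
  rintro ⟨M, hMcard, hMdisj, hMcov, hMinj⟩
  have two_m : k + 1 = 2 * ((k + 1) / 2) := by
    obtain ⟨r, rfl⟩ := hodd
    omega
  have trace_card : ∀ i (e : Finset (Fin n)), (e ∩ W = A i ∨ e ∩ W = W \ A i) →
      (e ∩ W).card = (k + 1) / 2 := by
    rintro i e (h | h)
    · rw [h, hAcard]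
    · rw [h, card_sdiff_of_subset (hAW i), hAcard, hW]
      omega
  -- Edges with complementary traces on `W` share a color, so they cannot both occur.
  have not_compl : ∀ e ∈ M, ∀ e' ∈ M, ∀ i, (e ∩ W = A i ∨ e ∩ W = W \ A i) →
      e' ∩ W ≠ W \ (e ∩ W) := by
    intro e he e' he' i hi hcompl
    have hi' : e' ∩ W = A i ∨ e' ∩ W = W \ A i := by
      rcases hi with h | h
      · exact Or.inr (by rw [hcompl, h])
      · exact Or.inl (by rw [hcompl, h, Finset.sdiff_sdiff_eq_self (hAW i)])
    have heq : e = e' := hMinj he he' <| by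
      rw [hcolA i e (hMcard e he) hi, hcolA i e' (hMcard e' he') hi']
    subst heq
    have hempty : e ∩ W = ∅ := by
      ext v
      have := Finset.ext_iff.mp hcompl v
      simp only [mem_sdiff, mem_inter] at this
      simp only [mem_inter, notMem_empty, iff_false]
      tauto
    have := trace_card i e hi
    rw [hempty, card_empty] at this
    omega
  have color_z : ∀ e ∈ M, ∀ v ∈ e, v ∈ W →
      (¬ ∃ i, e ∩ W = A i ∨ e ∩ W = W \ A i) → χ e = z := by
    intro e he v hve hvW hno
    push Not at hno
    refine hcolz e (hMcard e he) (fun hsub => ?_) hno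
    exact (mem_sdiff.mp (hsub hve)).2 hvW
  by_cases hex : ∃ e ∈ M, ∃ i, e ∩ W = A i ∨ e ∩ W = W \ A i
  · obtain ⟨e, he, i, hi⟩ := hex
    have htrace := trace_card i e hi
    have trace_sub : ∀ e' ∈ M, e' ≠ e → e' ∩ W ⊆ W \ (e ∩ W) := by
      intro e' he' hne v hv
      have hd := disjoint_left.mp (hMdisj he' he hne)
      simp only [mem_inter, mem_sdiff] at hv ⊢
      exact ⟨hv.2, fun h => hd hv.1 h.1⟩
    have hcompl_card : (W \ (e ∩ W)).card = (k + 1) / 2 := by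
      rw [card_sdiff_of_subset inter_subset_right, htrace, hW]
      omega
    have no_other : ∀ e' ∈ M, e' ≠ e → ¬ ∃ j, e' ∩ W = A j ∨ e' ∩ W = W \ A j := by
      rintro e' he' hne ⟨j, hj⟩
      refine not_compl e he e' he' i hi (eq_of_subset_of_card_le (trace_sub e' he' hne) ?_)
      rw [hcompl_card, trace_card j e' hj]
    have cover_z : ∀ v ∈ W \ (e ∩ W), ∃ e' ∈ M, v ∈ e' ∧ e' ≠ e ∧ χ e' = z := by
      intro v hv
      obtain ⟨e', he', hve'⟩ := hMcov v
      have hvW := (mem_sdiff.mp hv).1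
      have hne : e' ≠ e := by
        rintro rfl
        exact (mem_sdiff.mp hv).2 (mem_inter.mpr ⟨hve', hvW⟩)
      exact ⟨e', he', hve', hne, color_z e' he' v hve' hvW (no_other e' he' hne)⟩
    obtain ⟨v, hv⟩ : (W \ (e ∩ W)).Nonempty := card_pos.mp (by omega)
    obtain ⟨e', he', -, hne, hz⟩ := cover_z v hv
    refine not_compl e he e' he' i hi ((trace_sub e' he' hne).antisymm fun w hw => ?_)
    obtain ⟨e'', he'', hwe'', -, hz''⟩ := cover_z w hw
    have heq : e'' = e' := hMinj he'' he' (hz''.trans hz.symm)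
    exact mem_inter.mpr ⟨heq ▸ hwe'', (mem_sdiff.mp hw).1⟩
  · have cover_z : ∀ v ∈ W, ∃ e ∈ M, v ∈ e ∧ χ e = z := by
      intro v hv
      obtain ⟨e, he, hve⟩ := hMcov v
      exact ⟨e, he, hve, color_z e he v hve hv fun h => hex ⟨e, he, h⟩⟩
    obtain ⟨v, hv⟩ : W.Nonempty := card_pos.mp (by omega)
    obtain ⟨e, he, -, hz⟩ := cover_z v hv
    have hsub : W ⊆ e := by
      intro w hw
      obtain ⟨e', he', hwe', hz'⟩ := cover_z w hw
      have heq : e' = e := hMinj he' he (hz'.trans hz.symm)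
      exact heq ▸ hwe'
    have := card_le_card hsub
    rw [hMcard e he, hW] at this
    omega
end

section
/- Let k ≥ 4 be an even integer and n = ks with s ≥ 3. Let W ⊆ [n] with |W| = k+1, U = [n] \ W, fix x ∈ W, let f be an injective coloring of the k-subsets of U, and let B_1, …, B_N (N = binom(k, k/2 − 1)) be all the (k/2 − 1)-element subsets of W \ {x}. For each i let 𝔅_i be the set of edges e of K^k_n with either (x ∈ e and e ∩ W = B_i ∪ {x}) or e ∩ W = W \ (B_i ∪ {x}). Color K^k_n as follows: edges inside U get their f-color; edges in 𝔅_i get a new color c_i (distinct colors for distinct i, all distinct from the f-colors); every other edge gets one further color 0. Then this edge-coloring of K^k_n contains no rainbow perfect matching. -/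
open Finset

/-- The coloring of `K^k_n` (for even `k`, `n = ks`) built from an injective coloring of the
`k`-subsets of `U = [n] \ W`, new colors `c i` on the edges `e` with either `x ∈ e` and
`e ∩ W = B i ∪ {x}`, or `e ∩ W = W \ (B i ∪ {x})`, and one further color `z` on all remaining
edges, has no rainbow perfect matching. -/
theorem no_rainbow_perfect_matching_even (k s n : ℕ)
    (hk : 4 ≤ k) (heven : Even k) (hs : 3 ≤ s) (hn : n = k * s)
    (W : Finset (Fin n)) (hW : W.card = k + 1) (x : Fin n) (hx : x ∈ W)
    (N : ℕ) (hN : N = k.choose (k / 2 - 1))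
    (B : Fin N → Finset (Fin n)) (hBinj : Function.Injective B)
    (hBW : ∀ i, B i ⊆ W.erase x) (hBcard : ∀ i, (B i).card = k / 2 - 1)
    (hBall : ∀ C ⊆ W.erase x, C.card = k / 2 - 1 → ∃ i, B i = C)
    (χ : Finset (Fin n) → ℕ) (c : Fin N → ℕ) (z : ℕ)
    (hinjU : Set.InjOn χ {e : Finset (Fin n) | e ⊆ Finset.univ \ W ∧ e.card = k})
    (hcolB : ∀ i, ∀ e : Finset (Fin n), e.card = k →
        ((x ∈ e ∧ e ∩ W = insert x (B i)) ∨ e ∩ W = W \ insert x (B i)) → χ e = c i)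
    (hcinj : Function.Injective c)
    (hcnew : ∀ i, ∀ e : Finset (Fin n), e ⊆ Finset.univ \ W → e.card = k → χ e ≠ c i)
    (hcolz : ∀ e : Finset (Fin n), e.card = k → ¬ e ⊆ Finset.univ \ W →
        (∀ i, ¬ (x ∈ e ∧ e ∩ W = insert x (B i)) ∧ e ∩ W ≠ W \ insert x (B i)) → χ e = z)
    (hznew : ∀ e : Finset (Fin n), e ⊆ Finset.univ \ W → e.card = k → χ e ≠ z)
    (hzc : ∀ i, c i ≠ z) :
    ¬ ∃ M : Finset (Finset (Fin n)), (∀ e ∈ M, e.card = k) ∧ IsMatchingFam M ∧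
        (∀ v : Fin n, ∃ e ∈ M, v ∈ e) ∧ Set.InjOn χ ↑M := by
  rintro ⟨M, hMcard, hMdisj, hMcov, hMinj⟩
  have hshare : ∀ e ∈ M, ∀ e' ∈ M, ∀ v, v ∈ e → v ∈ e' → e = e' := by
    intro e he e' he' v hv hv'
    by_contra hne
    exact Finset.disjoint_left.1 (hMdisj he he' hne) hv hv'
  have hins : ∀ i, insert x (B i) ⊆ W := fun i =>
    Finset.insert_subset hx ((hBW i).trans (Finset.erase_subset _ _))
  obtain ⟨m, rfl⟩ := heven
  have hinscard : ∀ i, (insert x (B i)).card = m := by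
    intro i
    rw [Finset.card_insert_of_notMem (fun h => Finset.notMem_erase x W (hBW i h)), hBcard]
    omega
  have hcompcard : ∀ i, (W \ insert x (B i)).card = m + 1 := by
    intro i
    rw [Finset.card_sdiff_of_subset (hins i), hinscard, hW]
    omega
  have hclass : ∀ e ∈ M, ∀ v ∈ e, v ∈ W → (∃ i, x ∈ e ∧ e ∩ W = insert x (B i)) ∨
      (∃ i, e ∩ W = W \ insert x (B i)) ∨ χ e = z := by
    intro e he v hv hvW
    by_contra! hcon
    refine hcon.2.2 (hcolz e (hMcard e he) ?_ fun i => ⟨fun h => hcon.1 i h.1 h.2, hcon.2.1 i⟩)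
    intro hsub
    exact (Finset.mem_sdiff.1 (hsub hv)).2 hvW
  obtain ⟨e, he, hxe⟩ := hMcov x
  rcases hclass e he x hxe hx with ⟨i, -, hi⟩ | ⟨i, hi⟩ | hz
  · have hcol : χ e = c i := hcolB i e (hMcard e he) (Or.inl ⟨hxe, hi⟩)
    have hout : ∀ v ∈ W, v ∉ insert x (B i) → v ∉ e := by
      intro v hv hv' hve
      exact hv' (hi ▸ Finset.mem_inter.2 ⟨hve, hv⟩)
    have hin : ∀ v ∈ insert x (B i), v ∈ e := fun v hv => (Finset.mem_inter.1 (hi ▸ hv)).1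
    have hfalse : ∀ e' ∈ M, e' ≠ e → e' ∩ W ≠ W \ insert x (B i) := by
      intro e' he' hne htr
      exact hne (hMinj he' he ((hcolB i e' (hMcard e' he') (Or.inr htr)).trans hcol.symm))
    have hsub : ∀ e' ∈ M, e' ≠ e → e' ∩ W ⊆ W \ insert x (B i) := by
      intro e' he' hne v hv
      rw [Finset.mem_inter] at hv
      exact Finset.mem_sdiff.2 ⟨hv.2, fun h => hne (hshare e' he' e he v hv.1 (hin v h))⟩
    have hother : ∀ v ∈ W \ insert x (B i), ∃ e' ∈ M, e' ≠ e ∧ v ∈ e' ∧ χ e' = z := by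
      intro v hv
      rw [Finset.mem_sdiff] at hv
      obtain ⟨e', he', hve'⟩ := hMcov v
      have hne : e' ≠ e := by
        rintro rfl
        exact hout v hv.1 hv.2 hve'
      rcases hclass e' he' v hve' hv.1 with ⟨j, hxj, -⟩ | ⟨j, hj⟩ | hz
      · exact (hne (hshare e' he' e he x hxj hxe)).elim
      · refine (hfalse e' he' hne (Finset.eq_of_subset_of_card_le (hsub e' he' hne) ?_)).elim
        rw [hj, hcompcard, hcompcard]
      · exact ⟨e', he', hne, hve', hz⟩
    obtain ⟨v, hv⟩ : (W \ insert x (B i)).Nonempty := by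
      rw [← Finset.card_pos, hcompcard]
      omega
    obtain ⟨e', he', hne, -, hz⟩ := hother v hv
    refine hfalse e' he' hne ((hsub e' he' hne).antisymm fun w hw => ?_)
    obtain ⟨e₂, he₂, -, hw₂, hz₂⟩ := hother w hw
    rw [hMinj he' he₂ (hz.trans hz₂.symm)]
    exact Finset.mem_inter.2 ⟨hw₂, (Finset.mem_sdiff.1 hw).1⟩
  · have hmem : x ∈ W \ insert x (B i) := hi ▸ Finset.mem_inter.2 ⟨hxe, hx⟩
    exact (Finset.mem_sdiff.1 hmem).2 (Finset.mem_insert_self _ _)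
  · have hother : ∀ e' ∈ M, e' ≠ e → ∀ v ∈ e', v ∈ W → ∃ i, e' ∩ W = W \ insert x (B i) := by
      intro e' he' hne v hv hvW
      rcases hclass e' he' v hv hvW with ⟨j, hxj, -⟩ | h | hz'
      · exact (hne (hshare e' he' e he x hxj hxe)).elim
      · exact h
      · exact (hne (hMinj he' he (hz'.trans hz.symm))).elim
    obtain ⟨y, hyW, hye⟩ : ∃ y ∈ W, y ∉ e := by
      by_contra! hsub
      have hle := Finset.card_le_card hsub
      rw [hW, hMcard e he] at hle
      omega
    obtain ⟨e', he', hye'⟩ := hMcov y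
    have hne : e' ≠ e := by
      rintro rfl
      exact hye hye'
    obtain ⟨i, hi⟩ := hother e' he' hne y hye' hyW
    have hin : ∀ v ∈ W, v ∉ insert x (B i) → v ∈ e' := fun v hv hv' =>
      (Finset.mem_inter.1 (hi ▸ Finset.mem_sdiff.2 ⟨hv, hv'⟩)).1
    have hout : ∀ v ∈ insert x (B i), v ∉ e' := by
      intro v hv hve'
      have hmem : v ∈ W \ insert x (B i) := hi ▸ Finset.mem_inter.2 ⟨hve', hins i hv⟩
      exact (Finset.mem_sdiff.1 hmem).2 hv
    have hsub : ∀ e₂ ∈ M, e₂ ≠ e' → e₂ ∩ W ⊆ insert x (B i) := by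
      intro e₂ he₂ hne₂ v hv
      rw [Finset.mem_inter] at hv
      by_contra hv'
      exact hne₂ (hshare e₂ he₂ e' he' v hv.1 (hin v hv.2 hv'))
    have htrace : e ∩ W = insert x (B i) := by
      refine (hsub e he hne.symm).antisymm fun w hw => Finset.mem_inter.2 ⟨?_, hins i hw⟩
      obtain ⟨e₂, he₂, hwe₂⟩ := hMcov w
      by_contra hwe
      have hne₂ : e₂ ≠ e := by
        rintro rfl
        exact hwe hwe₂
      obtain ⟨j, hj⟩ := hother e₂ he₂ hne₂ w hwe₂ (hins i hw)
      have hne' : e₂ ≠ e' := by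
        rintro rfl
        exact hout w hw hwe₂
      have hle := Finset.card_le_card (hsub e₂ he₂ hne')
      rw [hj, hcompcard, hinscard] at hle
      omega
    exact hzc i ((hcolB i e (hMcard e he) (Or.inl ⟨hxe, htrace⟩)).symm.trans hz)
end

section
/- There exists ε_0 > 0 such that for every ε with 0 < ε < ε_0 there is a positive integer n_0 with the following property. Let H be a 3-graph on n > n_0 vertices and let s be an integer with 5n/18 − 1 ≤ s ≤ 13n/45. If ν(H) ≤ s, e(H) > binom(3s+1, 3) + 3s(n − 3s − 1), and H ε-contains D^3_{n,s}, then H is a subgraph of D^3_{n,s}, i.e., there is a vertex set U of size 3s+2 containing every edge of H. -/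
open Finset

/-- The edge set of the complete `k`-uniform hypergraph on vertex set `Fin n`. -/
def completeEdges (n k : ℕ) : Finset (Finset (Fin n)) :=
  Finset.powersetCard k Finset.univ

theorem IsMatchingFam.mono {α : Type*} [DecidableEq α] {M N : Finset (Finset α)}
    (hN : IsMatchingFam N) (h : M ⊆ N) : IsMatchingFam M :=
  Set.Pairwise.mono (Finset.coe_subset.2 h) hN

theorem IsMatchingFam.insert {α : Type*} [DecidableEq α] {M : Finset (Finset α)}
    {e : Finset α} (hM : IsMatchingFam M) (h : ∀ f ∈ M, Disjoint e f) :
    IsMatchingFam (insert e M) := by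
  unfold IsMatchingFam at *
  rw [Finset.coe_insert]
  exact hM.insert fun f hf _ => ⟨h f hf, (h f hf).symm⟩

theorem IsMatchingFam.union {α : Type*} [DecidableEq α] {M N : Finset (Finset α)}
    (hM : IsMatchingFam M) (hN : IsMatchingFam N) (h : ∀ e ∈ M, ∀ f ∈ N, Disjoint e f) :
    IsMatchingFam (M ∪ N) := by
  intro e he f hf hef
  simp only [Finset.coe_union, Set.mem_union, Finset.mem_coe] at he hf
  rcases he with he | he <;> rcases hf with hf | hf
  · exact hM he hf hef
  · exact h e he f hf
  · exact (h f hf e he).symm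
  · exact hN he hf hef

theorem card_le_of_meets {n : ℕ} {F : Finset (Finset (Fin n))} {v : Fin n} {S : Finset (Fin n)}
    (hv : v ∉ S) (hF : ∀ e ∈ F, e.card = 3 ∧ v ∈ e ∧ ¬ Disjoint e S) :
    F.card ≤ S.card * n := by
  have hsub : F ⊆ (S ×ˢ (univ : Finset (Fin n))).image (fun p => {v, p.1, p.2}) := by
    intro e he
    obtain ⟨h3, hve, hS⟩ := hF e he
    obtain ⟨a, hae, haS⟩ := Finset.not_disjoint_iff.1 hS
    have hav : a ≠ v := fun h => hv (h ▸ haS)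
    have h1 : ((e.erase v).erase a).card = 1 := by
      rw [card_erase_of_mem (mem_erase.2 ⟨hav, hae⟩), card_erase_of_mem hve, h3]
    obtain ⟨b, hb⟩ := card_eq_one.1 h1
    refine mem_image.2 ⟨(a, b), by simp [haS], ?_⟩
    rw [← insert_erase hve, ← insert_erase (mem_erase.2 ⟨hav, hae⟩ : a ∈ e.erase v), hb]
  calc F.card ≤ _ := card_le_card hsub
    _ ≤ _ := card_image_le
    _ = _ := by simp

theorem exists_disjoint_of_card_lt {n : ℕ} {F : Finset (Finset (Fin n))} {v : Fin n}
    {S : Finset (Fin n)} (hv : v ∉ S) (hF : ∀ e ∈ F, e.card = 3 ∧ v ∈ e)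
    (hc : S.card * n < F.card) : ∃ e ∈ F, Disjoint e S := by
  by_contra! h
  exact absurd (card_le_of_meets hv fun e he => ⟨(hF e he).1, (hF e he).2, h e he⟩) (by omega)

theorem IsMatchingFam.card_biUnion {n : ℕ} {M : Finset (Finset (Fin n))}
    (hM : IsMatchingFam M) (h3 : ∀ e ∈ M, e.card = 3) : (M.biUnion id).card = 3 * M.card := by
  rw [Finset.card_biUnion (t := id) (fun e he f hf hef => hM he hf hef)]
  simp only [id]
  rw [sum_const_nat h3, mul_comm]

/-- A 3-graph on a large vertex set `P` in which every vertex lies in few missing triples has a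
matching covering all but at most two vertices of `P`. -/
theorem exists_matching_of_few_missing {n : ℕ} (hn : 100 ≤ n) {H : Finset (Finset (Fin n))}
    (hH : ∀ e ∈ H, e.card = 3) {P : Finset (Fin n)} (hP : 4 * n ≤ 5 * P.card)
    (hmiss : ∀ x ∈ P, 10000 * ((powersetCard 3 P \ H).filter (x ∈ ·)).card ≤ n ^ 2) :
    ∃ M ⊆ H, IsMatchingFam M ∧ (∀ e ∈ M, e ⊆ P) ∧ P.card ≤ 3 * M.card + 2 := by
  classical
  obtain ⟨M, hMmem, hMmax⟩ := exists_max_image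
    (H.powerset.filter (fun M => IsMatchingFam M ∧ ∀ e ∈ M, e ⊆ P)) card
    ⟨∅, mem_filter.2 ⟨by simp, by simp [IsMatchingFam], by simp⟩⟩
  simp only [mem_filter, mem_powerset] at hMmem hMmax
  obtain ⟨hMH, hM, hMP⟩ := hMmem
  refine ⟨M, hMH, hM, hMP, ?_⟩
  by_contra! hlt
  have hTc := hM.card_biUnion (fun e he => hH e (hMH he))
  set T := M.biUnion id with hT
  have hsubT : ∀ e ∈ M, e ⊆ T := fun e he => subset_biUnion_of_mem id he
  have hTP : T ⊆ P := biUnion_subset.2 hMP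
  have hLc : (P \ T).card = P.card - 3 * M.card := by rw [card_sdiff_of_subset hTP, hTc]
  obtain ⟨X, hXL, hX3⟩ := exists_subset_card_eq (show 3 ≤ (P \ T).card by omega)
  obtain ⟨x, y, z, hxy, hxz, hyz, rfl⟩ := card_eq_three.1 hX3
  have hx : x ∈ P \ T := hXL (by simp)
  have hy : y ∈ P \ T := hXL (by simp)
  have hz : z ∈ P \ T := hXL (by simp)
  have hnoedge : ∀ e ∈ H, ¬ e ⊆ P \ T := by
    intro e he heL
    have hd : ∀ f ∈ M, Disjoint e f := fun f hf =>
      disjoint_sdiff_self_left.mono heL (hsubT f hf)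
    have hne : e ∉ M := fun h => by
      have h0 := disjoint_self.1 (hd e h)
      have h3 := hH e he
      rw [h0] at h3
      simp at h3
    have := hMmax (insert e M) ⟨insert_subset he hMH, hM.insert hd, by
      intro f hf
      rcases mem_insert.1 hf with rfl | hf
      · exact heL.trans sdiff_subset
      · exact hMP f hf⟩
    rw [card_insert_of_notMem hne] at this
    omega
  have hk : n ≤ 10 * M.card := by
    have h1 : ((powersetCard 2 ((P \ T).erase x)).image (fun s => insert x s)).card
        ≤ ((powersetCard 3 P \ H).filter (x ∈ ·)).card := by
      apply card_le_card
      intro e he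
      obtain ⟨q, hq, rfl⟩ := mem_image.1 he
      obtain ⟨hqs, hq2⟩ := mem_powersetCard.1 hq
      have hxq : x ∉ q := fun h => by simpa using hqs h
      have hsub : insert x q ⊆ P \ T :=
        insert_subset hx (hqs.trans (erase_subset _ _))
      simp only [mem_filter, mem_sdiff, mem_powersetCard, mem_insert_self, and_true]
      exact ⟨⟨hsub.trans sdiff_subset, by rw [card_insert_of_notMem hxq, hq2]⟩,
        fun h => hnoedge _ h hsub⟩
    rw [card_image_of_injOn, card_powersetCard, card_erase_of_mem hx] at h1
    · have h2 := hmiss x (sdiff_subset hx)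
      rw [Nat.choose_two_right] at h1
      have h4 : ((P \ T).card - 1) * ((P \ T).card - 1 - 1) ≤
          2 * (((P \ T).card - 1) * ((P \ T).card - 1 - 1) / 2) := by
        have := Nat.even_mul_pred_self ((P \ T).card - 1)
        obtain ⟨c, hc⟩ := this
        omega
      by_contra! hk
      have h5 : n ≤ 4 * ((P \ T).card - 1 - 1) := by omega
      have h6 : n ≤ 4 * ((P \ T).card - 1) := by omega
      have h7 := Nat.mul_le_mul h6 h5
      nlinarith
    · intro a ha b hb hab
      have hxa : x ∉ a := fun h => by simpa using (mem_powersetCard.1 ha).1 h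
      have hxb : x ∉ b := fun h => by simpa using (mem_powersetCard.1 hb).1 h
      have hab' : insert x a = insert x b := hab
      rw [← erase_insert hxa, hab', erase_insert hxb]
  have hblock : ∀ p ∈ M.offDiag, ∃ q : Fin n × Fin n, q.1 ∈ p.1 ∧ q.2 ∈ p.2 ∧
      ∃ w ∈ ({x, y, z} : Finset (Fin n)), ({w, q.1, q.2} : Finset (Fin n)) ∉ H := by
    rintro ⟨e, f⟩ hp
    obtain ⟨he, hf, hef⟩ := mem_offDiag.1 hp
    simp only at he hf hef ⊢
    by_contra! hcon
    obtain ⟨a₁, a₂, a₃, ha12, ha13, ha23, hae⟩ := card_eq_three.1 (hH e (hMH he))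
    obtain ⟨b₁, b₂, b₃, hb12, hb13, hb23, hbf⟩ := card_eq_three.1 (hH f (hMH hf))
    have hdef : Disjoint e f := hM he hf hef
    have hnT : ∀ u ∈ P \ T, ∀ g ∈ M, u ∉ g := fun u hu g hg hug =>
      (mem_sdiff.1 hu).2 (hsubT g hg hug)
    have key : ∀ w ∈ ({x, y, z} : Finset (Fin n)), ∀ a ∈ e, ∀ b ∈ f,
        ({w, a, b} : Finset (Fin n)) ∈ H := fun w hw a ha b hb => hcon (a, b) ha hb w hw
    have keyP : ∀ w ∈ ({x, y, z} : Finset (Fin n)), ∀ a ∈ e, ∀ b ∈ f,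
        ({w, a, b} : Finset (Fin n)) ⊆ P := by
      intro w hw a ha b hb u hu
      simp only [mem_insert, mem_singleton] at hu
      rcases hu with rfl | rfl | rfl
      · exact (mem_sdiff.1 (hXL hw)).1
      · exact hMP e he ha
      · exact hMP f hf hb
    have keyd : ∀ w ∈ ({x, y, z} : Finset (Fin n)), ∀ a ∈ e, ∀ b ∈ f,
        ∀ g ∈ (M.erase e).erase f, Disjoint ({w, a, b} : Finset (Fin n)) g := by
      intro w hw a ha b hb g hg
      simp only [mem_erase] at hg
      rw [disjoint_left]
      intro u hu hug
      simp only [mem_insert, mem_singleton] at hu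
      rcases hu with rfl | rfl | rfl
      · exact hnT _ (hXL hw) g hg.2.2 hug
      · exact disjoint_left.1 (hM he hg.2.2 (Ne.symm hg.2.1)) ha hug
      · exact disjoint_left.1 (hM hf hg.2.2 (Ne.symm hg.1)) hb hug
    have m1 : a₁ ∈ e := by simp [hae]
    have m2 : a₂ ∈ e := by simp [hae]
    have m3 : a₃ ∈ e := by simp [hae]
    have l1 : b₁ ∈ f := by simp [hbf]
    have l2 : b₂ ∈ f := by simp [hbf]
    have l3 : b₃ ∈ f := by simp [hbf]
    have hX1 : x ∈ ({x, y, z} : Finset (Fin n)) := by simp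
    have hX2 : y ∈ ({x, y, z} : Finset (Fin n)) := by simp
    have hX3' : z ∈ ({x, y, z} : Finset (Fin n)) := by simp
    have gen : ∀ w ∈ ({x, y, z} : Finset (Fin n)), ∀ w' ∈ ({x, y, z} : Finset (Fin n)),
        ∀ a ∈ e, ∀ a' ∈ e, ∀ b ∈ f, ∀ b' ∈ f, w ≠ w' → a ≠ a' → b ≠ b' →
        Disjoint ({w, a, b} : Finset (Fin n)) {w', a', b'} := by
      intro w hw w' hw' a ha a' ha' b hb b' hb' h1 h2 h3
      have hwe := hnT w (hXL hw) e he
      have hwf := hnT w (hXL hw) f hf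
      have hwe' := hnT w' (hXL hw') e he
      have hwf' := hnT w' (hXL hw') f hf
      have hde := disjoint_left.1 hdef
      rw [disjoint_left]
      intro u hu hu'
      simp only [mem_insert, mem_singleton] at hu hu'
      rcases hu with rfl | rfl | rfl
      · rcases hu' with h | h | h
        exacts [h1 h, hwe (h ▸ ha'), hwf (h ▸ hb')]
      · rcases hu' with h | h | h
        exacts [hwe' (h ▸ ha), h2 h, hde ha (h ▸ hb')]
      · rcases hu' with h | h | h
        exacts [hwf' (h ▸ hb), hde ha' (h ▸ hb), h3 h]
    have d12 := gen x hX1 y hX2 a₁ m1 a₂ m2 b₁ l1 b₂ l2 hxy ha12 hb12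
    have d13 := gen x hX1 z hX3' a₁ m1 a₃ m3 b₁ l1 b₃ l3 hxz ha13 hb13
    have d23 := gen y hX2 z hX3' a₂ m2 a₃ m3 b₂ l2 b₃ l3 hyz ha23 hb23
    set M₀ := (M.erase e).erase f with hM₀
    have hM₀M : M₀ ⊆ M := (erase_subset _ _).trans (erase_subset _ _)
    have i3 : ∀ g ∈ M₀, Disjoint ({z, a₃, b₃} : Finset (Fin n)) g := keyd z hX3' a₃ m3 b₃ l3
    have i2 : ∀ g ∈ insert ({z, a₃, b₃} : Finset (Fin n)) M₀,
        Disjoint ({y, a₂, b₂} : Finset (Fin n)) g := by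
      intro g hg
      rcases mem_insert.1 hg with rfl | hg
      · exact d23
      · exact keyd y hX2 a₂ m2 b₂ l2 g hg
    have i1 : ∀ g ∈ insert ({y, a₂, b₂} : Finset (Fin n)) (insert {z, a₃, b₃} M₀),
        Disjoint ({x, a₁, b₁} : Finset (Fin n)) g := by
      intro g hg
      rcases mem_insert.1 hg with rfl | hg
      · exact d12
      rcases mem_insert.1 hg with rfl | hg
      · exact d13
      · exact keyd x hX1 a₁ m1 b₁ l1 g hg
    have notin : ∀ (g : Finset (Fin n)) (N : Finset (Finset (Fin n))), g.Nonempty →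
        (∀ h ∈ N, Disjoint g h) → g ∉ N := by
      intro g N hg h hgN
      exact hg.ne_empty (disjoint_self.1 (h g hgN))
    have hmat := (((hM.mono hM₀M).insert i3).insert i2).insert i1
    have hcard := hMmax _ ⟨insert_subset (key x hX1 a₁ m1 b₁ l1)
      (insert_subset (key y hX2 a₂ m2 b₂ l2) (insert_subset (key z hX3' a₃ m3 b₃ l3)
        (hM₀M.trans hMH))), hmat, by
      intro g hg
      simp only [mem_insert] at hg
      rcases hg with rfl | rfl | rfl | hg
      · exact keyP x hX1 a₁ m1 b₁ l1
      · exact keyP y hX2 a₂ m2 b₂ l2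
      · exact keyP z hX3' a₃ m3 b₃ l3
      · exact hMP g (hM₀M hg)⟩
    rw [card_insert_of_notMem (notin _ _ ⟨x, by simp⟩ i1),
      card_insert_of_notMem (notin _ _ ⟨y, by simp⟩ i2),
      card_insert_of_notMem (notin _ _ ⟨z, by simp⟩ i3),
      card_erase_of_mem (mem_erase.2 ⟨hef.symm, hf⟩), card_erase_of_mem he] at hcard
    omega
  have : Nonempty (Fin n × Fin n) := ⟨(x, x)⟩
  choose! φ hφ1 hφ2 hφ3 using hblock
  set Q := ({x, y, z} : Finset (Fin n)).biUnion fun w =>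
    ((powersetCard 3 P \ H).filter (w ∈ ·)).biUnion fun e => e ×ˢ e with hQ
  have hmaps : Set.MapsTo φ (M.offDiag : Set (Finset (Fin n) × Finset (Fin n)))
      (Q : Set (Fin n × Fin n)) := by
    intro p hp
    have hp' := mem_offDiag.1 (mem_coe.1 hp)
    obtain ⟨w, hw, hwH⟩ := hφ3 p hp
    have h1 := hφ1 p hp
    have h2 := hφ2 p hp
    have hwL := hXL hw
    have hwn : ∀ g ∈ M, w ∉ g := fun g hg hug => (mem_sdiff.1 hwL).2 (hsubT g hg hug)
    have hw1 : w ≠ (φ p).1 := fun h => hwn _ hp'.1 (h ▸ h1)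
    have hw2 : w ≠ (φ p).2 := fun h => hwn _ hp'.2.1 (h ▸ h2)
    have h12 : (φ p).1 ≠ (φ p).2 := fun h =>
      disjoint_left.1 (hM hp'.1 hp'.2.1 hp'.2.2) h1 (h ▸ h2)
    simp only [hQ, coe_biUnion, Set.mem_iUnion, mem_coe, mem_filter, mem_sdiff,
      mem_powersetCard, mem_product, exists_prop]
    refine ⟨w, hw, {w, (φ p).1, (φ p).2}, ⟨⟨⟨?_, ?_⟩, hwH⟩, by simp⟩, by simp⟩
    · intro u hu
      simp only [mem_insert, mem_singleton] at hu
      rcases hu with rfl | rfl | rfl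
      · exact (mem_sdiff.1 hwL).1
      · exact hMP _ hp'.1 h1
      · exact hMP _ hp'.2.1 h2
    · exact card_eq_three.2 ⟨_, _, _, hw1, hw2, h12, rfl⟩
  have hinj : Set.InjOn φ (M.offDiag : Set (Finset (Fin n) × Finset (Fin n))) := by
    intro p hp q hq hpq
    have hp' := mem_offDiag.1 (mem_coe.1 hp)
    have hq' := mem_offDiag.1 (mem_coe.1 hq)
    have e1 : p.1 = q.1 := by
      by_contra hne
      exact disjoint_left.1 (hM hp'.1 hq'.1 hne) (hφ1 p hp) (hpq ▸ hφ1 q hq)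
    have e2 : p.2 = q.2 := by
      by_contra hne
      exact disjoint_left.1 (hM hp'.2.1 hq'.2.1 hne) (hφ2 p hp) (hpq ▸ hφ2 q hq)
    exact Prod.ext e1 e2
  have hcount := card_le_card_of_injOn φ hmaps hinj
  have hQc : 10000 * Q.card ≤ 27 * n ^ 2 := by
    have h1 : Q.card ≤ ∑ w ∈ ({x, y, z} : Finset (Fin n)),
        ((powersetCard 3 P \ H).filter (w ∈ ·)).card * 9 := by
      refine card_biUnion_le.trans (sum_le_sum fun w hw => ?_)
      refine card_biUnion_le_card_mul _ _ _ fun e he => ?_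
      simp only [mem_filter, mem_sdiff, mem_powersetCard] at he
      simp [he.1.1.2]
    have h2 : ∑ w ∈ ({x, y, z} : Finset (Fin n)),
        10000 * (((powersetCard 3 P \ H).filter (w ∈ ·)).card * 9) ≤
        ∑ w ∈ ({x, y, z} : Finset (Fin n)), 9 * n ^ 2 := by
      refine sum_le_sum fun w hw => ?_
      have := hmiss w (mem_sdiff.1 (hXL hw)).1
      omega
    rw [← mul_sum, sum_const, hX3] at h2
    simp only [smul_eq_mul] at h2
    omega
  rw [offDiag_card] at hcount
  have h8 : M.card * M.card ≤ Q.card + M.card := by omega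
  nlinarith

/-- If `P` agrees with `U` up to few vertices, most vertices of `U` lie in almost all triples of
`U`, and every vertex of `P` forms an edge with many pairs of `U`, then some matching covers all
but at most two vertices of `P`. -/
theorem exists_matching_of_almost_complete {n : ℕ} (hn : 100 ≤ n) {H : Finset (Finset (Fin n))}
    (hH : ∀ e ∈ H, e.card = 3) {U A : Finset (Fin n)} (hAU : A ⊆ U)
    (hU : 82 * n ≤ 100 * U.card)
    (hA : ∀ x ∈ A, 10000 * ((powersetCard 3 U \ H).filter (x ∈ ·)).card ≤ n ^ 2)
    (P : Finset (Fin n))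
    (hP : ∀ x ∈ P, n ^ 2 < 2000 * (H.filter (fun e => x ∈ e ∧ e.erase x ⊆ U)).card)
    (hc : 2000 * ((U \ (P ∩ A)).card + 2 * (P \ A).card) ≤ n) :
    ∃ M ⊆ H, IsMatchingFam M ∧ (∀ e ∈ M, e ⊆ P) ∧ P.card ≤ 3 * M.card + 2 := by
  induction hk : (P \ A).card generalizing P with
  | zero =>
    have hPA : P ⊆ A := by
      rw [card_eq_zero] at hk
      exact sdiff_eq_empty_iff_subset.1 hk
    refine exists_matching_of_few_missing hn hH ?_ fun x hx => ?_
    · rw [inter_eq_left.2 hPA, card_sdiff_of_subset (hPA.trans hAU)] at hc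
      omega
    · refine le_trans (Nat.mul_le_mul_left _ (card_le_card ?_)) (hA x (hPA hx))
      exact filter_subset_filter _
        (sdiff_subset_sdiff (powersetCard_mono (hPA.trans hAU)) le_rfl)
  | succ k ih =>
    obtain ⟨v, hv⟩ : (P \ A).Nonempty := card_pos.1 (by omega)
    obtain ⟨hvP, hvA⟩ := mem_sdiff.1 hv
    obtain ⟨e, he, hd⟩ := exists_disjoint_of_card_lt
      (F := H.filter (fun e => v ∈ e ∧ e.erase v ⊆ U)) (v := v)
      (S := (U \ (P ∩ A)).erase v) (notMem_erase _ _)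
      (fun e he => ⟨hH e (mem_filter.1 he).1, (mem_filter.1 he).2.1⟩) (by
        have h1 := hP v hvP
        have h2 : ((U \ (P ∩ A)).erase v).card ≤ (U \ (P ∩ A)).card := card_erase_le
        have h3 := Nat.mul_le_mul_right n h2
        have h4 : 2000 * (U \ (P ∩ A)).card * n ≤ n * n := Nat.mul_le_mul_right n (by omega)
        nlinarith)
    obtain ⟨heH, hve, heU⟩ := mem_filter.1 he
    have heP : e.erase v ⊆ P ∩ A := by
      intro u hu
      by_contra hcon
      have huv := (mem_erase.1 hu).1
      exact disjoint_left.1 hd (mem_erase.1 hu).2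
        (mem_erase.2 ⟨huv, mem_sdiff.2 ⟨heU hu, hcon⟩⟩)
    have hePs : e ⊆ P := by
      rw [← insert_erase hve]
      exact insert_subset hvP (heP.trans inter_subset_left)
    have h3 := hH e heH
    have hk' : ((P \ e) \ A).card = k := by
      have : (P \ e) \ A = (P \ A).erase v := by
        ext u
        simp only [mem_sdiff, mem_erase]
        constructor
        · rintro ⟨⟨h1, h2⟩, h3⟩
          exact ⟨fun h => h2 (h ▸ hve), h1, h3⟩
        · rintro ⟨h1, h2, h3⟩
          exact ⟨⟨h2, fun h => h3 (mem_inter.1 (heP (mem_erase.2 ⟨h1, h⟩))).2⟩, h3⟩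
      rw [this, card_erase_of_mem hv]
      omega
    have hUc : (U \ ((P \ e) ∩ A)).card ≤ (U \ (P ∩ A)).card + 2 := by
      have hsub : U \ ((P \ e) ∩ A) ⊆ (U \ (P ∩ A)) ∪ e.erase v := by
        intro u hu
        simp only [mem_sdiff, mem_inter, mem_union, mem_erase] at hu ⊢
        by_cases hue : u ∈ e
        · by_cases huv : u = v
          · left
            exact ⟨hu.1, fun h => hvA (huv ▸ h.2)⟩
          · exact Or.inr ⟨huv, hue⟩
        · left
          exact ⟨hu.1, fun h => hu.2 ⟨⟨h.1, hue⟩, h.2⟩⟩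
      refine (card_le_card hsub).trans ((card_union_le _ _).trans ?_)
      rw [card_erase_of_mem hve, h3]
    obtain ⟨M, hMH, hM, hMP, hMc⟩ := ih (P \ e) (fun x hx => hP x (sdiff_subset hx))
      (by omega) hk'
    have hdis : ∀ f ∈ M, Disjoint e f := fun f hf =>
      (disjoint_sdiff_self_left.mono_left (hMP f hf)).symm
    have hnot : e ∉ M := fun h => by
      have h0 := disjoint_self.1 (hdis e h)
      simp [h0] at hve
    refine ⟨insert e M, insert_subset heH hMH, hM.insert hdis, ?_, ?_⟩
    · intro f hf
      rcases mem_insert.1 hf with rfl | hf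
      · exact hePs
      · exact (hMP f hf).trans sdiff_subset
    · rw [card_insert_of_notMem hnot]
      rw [card_sdiff_of_subset hePs] at hMc
      omega

theorem card_filter_mem_le {n : ℕ} {F : Finset (Finset (Fin n))} {v : Fin n}
    (hF : ∀ e ∈ F, e.card = 3 ∧ v ∈ e) (S : Finset (Fin n)) :
    F.card + S.card.choose 2 ≤ n.choose 2 + (F.filter (fun e => e.erase v ⊆ S)).card := by
  have hinj : Set.InjOn (fun e : Finset (Fin n) => e.erase v) (F : Set (Finset (Fin n))) := by
    intro e he f hf hef
    rw [← insert_erase (hF e he).2, ← insert_erase (hF f hf).2]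
    exact congrArg (insert v) hef
  have h1 : (F.filter (fun e => ¬ e.erase v ⊆ S)).card ≤
      (powersetCard 2 (univ : Finset (Fin n)) \ powersetCard 2 S).card := by
    refine card_le_card_of_injOn (fun e => e.erase v) ?_ (hinj.mono ?_)
    · intro e he
      obtain ⟨heF, heS⟩ := mem_filter.1 (mem_coe.1 he)
      refine mem_coe.2 (mem_sdiff.2 ⟨mem_powersetCard.2 ⟨subset_univ _, ?_⟩, fun h =>
        heS (mem_powersetCard.1 h).1⟩)
      rw [card_erase_of_mem (hF e heF).2, (hF e heF).1]
    · exact coe_subset.2 (filter_subset _ _)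
  have h2 := card_filter_add_card_filter_not (s := F) (fun e => e.erase v ⊆ S)
  rw [card_sdiff_of_subset (powersetCard_mono (subset_univ _)), card_powersetCard,
    card_powersetCard, card_univ, Fintype.card_fin] at h1
  have h3 : S.card.choose 2 ≤ n.choose 2 :=
    Nat.choose_le_choose 2 (by simpa using card_le_univ S)
  omega

theorem two_mul_choose_two (m : ℕ) : 2 * m.choose 2 = m * (m - 1) := by
  rw [Nat.choose_two_right]
  exact Nat.mul_div_cancel' (Nat.even_mul_pred_self m).two_dvd

theorem card_filter_mem_crossing_le {n : ℕ} (hn : 10000 ≤ n) {H : Finset (Finset (Fin n))}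
    (hH : ∀ e ∈ H, e.card = 3) {G : Finset (Fin n)} (hG : 8332 * n ≤ 10000 * G.card)
    (hr : ∀ r ∉ G, 1000 * (H.filter (fun e => r ∈ e ∧ e.erase r ⊆ G)).card ≤ n ^ 2)
    (v : Fin n) :
    1000 * ((H.filter (fun e => ¬ e ⊆ G)).filter (v ∈ ·)).card ≤ 156 * n ^ 2 := by
  have h1 := card_filter_mem_le (F := (H.filter (fun e => ¬ e ⊆ G)).filter (v ∈ ·)) (v := v)
    (fun e he => by
      simp only [mem_filter] at he
      exact ⟨hH e he.1.1, he.2⟩) (G.erase v)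
  have h2 : 1000 * (((H.filter (fun e => ¬ e ⊆ G)).filter (v ∈ ·)).filter
      (fun e => e.erase v ⊆ G.erase v)).card ≤ n ^ 2 := by
    by_cases hv : v ∈ G
    · rw [filter_eq_empty_iff.2]
      · simp
      · intro e he hsub
        simp only [mem_filter] at he
        refine he.1.2 ?_
        rw [← insert_erase he.2]
        exact insert_subset hv (hsub.trans (erase_subset _ _))
    · refine le_trans (Nat.mul_le_mul_left _ (card_le_card ?_)) (hr v hv)
      intro e he
      simp only [mem_filter] at he ⊢
      exact ⟨he.1.1.1, he.1.2, he.2.trans (erase_subset _ _)⟩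
  have h3 : G.card ≤ (G.erase v).card + 1 := by
    have := pred_card_le_card_erase (s := G) (a := v)
    omega
  have h4 := two_mul_choose_two n
  have h5 := two_mul_choose_two (G.erase v).card
  obtain ⟨t, ht⟩ : ∃ t, (G.erase v).card = t + 1 := ⟨(G.erase v).card - 1, by omega⟩
  obtain ⟨m, rfl⟩ : ∃ m, n = m + 1 := ⟨n - 1, by omega⟩
  rw [ht] at h1 h3 h5
  simp only [Nat.add_sub_cancel] at h4 h5
  have h6 : 8332 * m ≤ 10000 * t + 20000 := by omega
  have h7 : 83 * m ≤ 100 * t := by omega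
  nlinarith [Nat.mul_le_mul h6 h7, Nat.mul_le_mul h6 h6]

/-- If every matching of edges not contained in `G` has small weight, where an edge `e` weighs
`|e \ G|`, then few edges leave `G`. -/
theorem card_crossing_le {n : ℕ} (hn : 10000 ≤ n) {H : Finset (Finset (Fin n))}
    (hH : ∀ e ∈ H, e.card = 3) {G : Finset (Fin n)} (hG : 8332 * n ≤ 10000 * G.card)
    (hr : ∀ r ∉ G, 1000 * (H.filter (fun e => r ∈ e ∧ e.erase r ⊆ G)).card ≤ n ^ 2)
    {j : ℕ} (hj : 1000 * j ≤ n)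
    (hw : ∀ M ⊆ H.filter (fun e => ¬ e ⊆ G), IsMatchingFam M → ∑ e ∈ M, (e \ G).card ≤ j) :
    1000 * (H.filter (fun e => ¬ e ⊆ G)).card ≤ 235 * n ^ 2 * j := by
  classical
  have hD := card_filter_mem_crossing_le hn hH hG hr
  set F := H.filter (fun e => ¬ e ⊆ G) with hF
  have hF3 : ∀ e ∈ F, e.card = 3 := fun e he => hH e (mem_filter.1 he).1
  have hFpos : ∀ e ∈ F, 1 ≤ (e \ G).card := fun e he =>
    card_pos.2 (sdiff_nonempty.2 (mem_filter.1 he).2)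
  obtain ⟨M, hMmem, hMmax⟩ := exists_max_image
    (F.powerset.filter IsMatchingFam) (fun M => ∑ e ∈ M, (e \ G).card)
    ⟨∅, mem_filter.2 ⟨by simp, by simp [IsMatchingFam]⟩⟩
  simp only [mem_filter, mem_powerset] at hMmem hMmax
  obtain ⟨hMF, hM⟩ := hMmem
  set T := M.biUnion id with hT
  have hsubT : ∀ e ∈ M, e ⊆ T := fun e he => subset_biUnion_of_mem id he
  have hMj : M.card ≤ j := by
    refine le_trans ?_ (hw M hMF hM)
    rw [card_eq_sum_ones]
    exact sum_le_sum fun e he => hFpos e (hMF he)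
  have hTc : T.card ≤ 3 * j := by
    rw [hT, hM.card_biUnion fun e he => hF3 e (hMF he)]
    omega
  have notin : ∀ e ∈ F, ∀ N : Finset (Finset (Fin n)), (∀ f ∈ N, Disjoint e f) → e ∉ N := by
    intro e he N h heN
    have h0 := disjoint_self.1 (h e heN)
    have := hF3 e he
    rw [h0] at this
    simp at this
  have hcover : ∀ e ∈ F, ¬ Disjoint e T := by
    intro e he hd
    have hd' : ∀ f ∈ M, Disjoint e f := fun f hf => hd.mono_right (hsubT f hf)
    have h1 := hMmax (insert e M) ⟨insert_subset he hMF, hM.insert hd'⟩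
    rw [sum_insert (notin e he M hd')] at h1
    have := hFpos e he
    omega
  have hrest : ∀ e ∈ M, ∀ v ∈ e, ∀ f ∈ M.erase e, f ⊆ T.erase v := by
    intro e he v hv f hf u hu
    obtain ⟨hne, hfM⟩ := mem_erase.1 hf
    refine mem_erase.2 ⟨fun h => ?_, hsubT f hfM hu⟩
    exact disjoint_left.1 (hM hfM he hne) hu (h ▸ hv)
  have hErase : ∀ v, (T.erase v).card ≤ 3 * j := fun v => card_erase_le.trans hTc
  have hmain : ∀ e ∈ M, 1000 * ∑ v ∈ e, (F.filter (v ∈ ·)).card ≤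
      235 * n ^ 2 * (e \ G).card := by
    intro e he
    have heF := hMF he
    have hpos := hFpos e heF
    have hsumE := add_sum_erase M (fun e => (e \ G).card) he
    rcases Nat.lt_or_ge (e \ G).card 2 with hlt | hge
    · have h1 : (e \ G).card = 1 := by omega
      obtain ⟨r, hre⟩ := card_eq_one.1 h1
      have hr' : r ∈ e \ G := by simp [hre]
      obtain ⟨hrE, hrG⟩ := mem_sdiff.1 hr'
      have h2 : (e.erase r).card = 2 := by rw [card_erase_of_mem hrE, hF3 e heF]
      obtain ⟨g, g', hgg, hge⟩ := card_eq_two.1 h2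
      have hgE : g ∈ e := mem_of_mem_erase (show g ∈ e.erase r by rw [hge]; simp)
      have hgE' : g' ∈ e := mem_of_mem_erase (show g' ∈ e.erase r by rw [hge]; simp)
      have hlowr : 1000 * (F.filter (r ∈ ·)).card ≤ 5 * n ^ 2 := by
        by_contra! hcon
        have hsplit := card_filter_add_card_filter_not (s := F.filter (r ∈ ·))
          (fun e => e.erase r ⊆ G)
        have hsmall : 1000 * ((F.filter (r ∈ ·)).filter (fun e => e.erase r ⊆ G)).card
            ≤ n ^ 2 := by
          refine le_trans (Nat.mul_le_mul_left _ (card_le_card ?_)) (hr r hrG)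
          intro f hf
          simp only [mem_filter, hF] at hf ⊢
          exact ⟨hf.1.1.1, hf.1.2, hf.2⟩
        obtain ⟨f, hf, hfd⟩ := exists_disjoint_of_card_lt
          (F := (F.filter (r ∈ ·)).filter (fun e => ¬ e.erase r ⊆ G)) (v := r)
          (S := T.erase r) (notMem_erase _ _)
          (fun f hf => by
            simp only [mem_filter] at hf
            exact ⟨hF3 f hf.1.1, hf.1.2⟩)
          (by
            have h3 : 1000 * ((T.erase r).card * n) ≤ 3 * (n * n) := by
              have := hErase r
              nlinarith
            nlinarith)
        simp only [mem_filter] at hf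
        obtain ⟨⟨hfF, hrf⟩, hfG⟩ := hf
        have hd : ∀ k ∈ M.erase e, Disjoint f k := fun k hk =>
          hfd.mono_right (hrest e he r hrE k hk)
        have h3 := hMmax (insert f (M.erase e))
          ⟨insert_subset hfF ((erase_subset _ _).trans hMF),
            (hM.mono (erase_subset _ _)).insert hd⟩
        rw [sum_insert (notin f hfF _ hd)] at h3
        have h4 : 2 ≤ (f \ G).card := by
          obtain ⟨u, hu, huG⟩ := not_subset.1 hfG
          obtain ⟨hur, huf⟩ := mem_erase.1 hu
          refine one_lt_card.2 ⟨u, by simp [huf, huG], r, by simp [hrf, hrG], hur⟩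
        omega
      have hlowg : 1000 * (F.filter (g ∈ ·)).card ≤ 5 * n ^ 2 ∨
          1000 * (F.filter (g' ∈ ·)).card ≤ 5 * n ^ 2 := by
        by_contra! hcon
        obtain ⟨hc1, hc2⟩ := hcon
        obtain ⟨f, hf, hfd⟩ := exists_disjoint_of_card_lt
          (F := F.filter (g ∈ ·)) (v := g) (S := T.erase g) (notMem_erase _ _)
          (fun f hf => by
            simp only [mem_filter] at hf
            exact ⟨hF3 f hf.1, hf.2⟩)
          (by
            have h3 : 1000 * ((T.erase g).card * n) ≤ 3 * (n * n) := by
              have := hErase g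
              nlinarith
            nlinarith)
        obtain ⟨hfF, hgf⟩ := mem_filter.1 hf
        have hg'T : g' ∈ T.erase g := mem_erase.2 ⟨hgg.symm, hsubT e he hgE'⟩
        have hg'f : g' ∉ f := fun h => disjoint_left.1 hfd h hg'T
        obtain ⟨k, hk, hkd⟩ := exists_disjoint_of_card_lt
          (F := F.filter (g' ∈ ·)) (v := g') (S := T.erase g' ∪ f)
          (by simp [hg'f])
          (fun f hf => by
            simp only [mem_filter] at hf
            exact ⟨hF3 f hf.1, hf.2⟩)
          (by
            have h3 : (T.erase g' ∪ f).card ≤ 3 * j + 3 := by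
              refine (card_union_le _ _).trans ?_
              have := hErase g'
              have := hF3 f hfF
              omega
            have h4 : 1000 * ((T.erase g' ∪ f).card * n) ≤ 4 * (n * n) := by
              nlinarith
            nlinarith)
        obtain ⟨hkF, hgk⟩ := mem_filter.1 hk
        rw [disjoint_union_right] at hkd
        have hdk : ∀ l ∈ M.erase e, Disjoint k l := fun l hl =>
          hkd.1.mono_right (hrest e he g' hgE' l hl)
        have hdf : ∀ l ∈ insert k (M.erase e), Disjoint f l := by
          intro l hl
          rcases mem_insert.1 hl with rfl | hl
          · exact hkd.2.symm
          · exact hfd.mono_right (hrest e he g hgE l hl)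
        have h3 := hMmax (insert f (insert k (M.erase e)))
          ⟨insert_subset hfF (insert_subset hkF ((erase_subset _ _).trans hMF)),
            ((hM.mono (erase_subset _ _)).insert hdk).insert hdf⟩
        rw [sum_insert (notin f hfF _ hdf), sum_insert (notin k hkF _ hdk)] at h3
        have := hFpos f hfF
        have := hFpos k hkF
        omega
      rw [← add_sum_erase e _ hrE, hge, sum_pair hgg, h1]
      have := hD g
      have := hD g'
      rcases hlowg with h | h <;> omega
    · have h1 : ∑ v ∈ e, 1000 * (F.filter (v ∈ ·)).card ≤ ∑ v ∈ e, 156 * n ^ 2 :=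
        sum_le_sum fun v _ => hD v
      rw [← mul_sum, sum_const, hF3 e heF, smul_eq_mul] at h1
      have h2 := Nat.mul_le_mul_left (235 * n ^ 2) hge
      omega
  have hFsub : F ⊆ M.biUnion fun e => e.biUnion fun v => F.filter (v ∈ ·) := by
    intro f hf
    obtain ⟨u, huf, huT⟩ := not_disjoint_iff.1 (hcover f hf)
    obtain ⟨e, he, hue⟩ := mem_biUnion.1 huT
    exact mem_biUnion.2 ⟨e, he, mem_biUnion.2 ⟨u, hue, mem_filter.2 ⟨hf, huf⟩⟩⟩
  calc 1000 * F.card ≤ 1000 * ∑ e ∈ M, ∑ v ∈ e, (F.filter (v ∈ ·)).card := by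
        refine Nat.mul_le_mul_left _ ((card_le_card hFsub).trans (card_biUnion_le.trans ?_))
        exact sum_le_sum fun e _ => card_biUnion_le
    _ = ∑ e ∈ M, 1000 * ∑ v ∈ e, (F.filter (v ∈ ·)).card := mul_sum _ _ _
    _ ≤ ∑ e ∈ M, 235 * n ^ 2 * (e \ G).card := sum_le_sum hmain
    _ = 235 * n ^ 2 * ∑ e ∈ M, (e \ G).card := (mul_sum _ _ _).symm
    _ ≤ _ := Nat.mul_le_mul_left _ (hw M hMF hM)

/-- If the edges not contained in `G` pairwise intersect and each has just one vertex outside `G`,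
then there are at most as many of them as in a star. -/
theorem card_crossing_le_star {n : ℕ} {H : Finset (Finset (Fin n))}
    (hH : ∀ e ∈ H, e.card = 3) {G : Finset (Fin n)}
    (hG : n ^ 2 + 6000 * n ≤ 1000 * ((G.card - 1) * (n - G.card)))
    (hr : ∀ r ∉ G, 1000 * (H.filter (fun e => r ∈ e ∧ e.erase r ⊆ G)).card ≤ n ^ 2)
    (hw : ∀ M ⊆ H.filter (fun e => ¬ e ⊆ G), IsMatchingFam M → ∑ e ∈ M, (e \ G).card ≤ 1) :
    (H.filter (fun e => ¬ e ⊆ G)).card ≤ (G.card - 1) * (n - G.card) := by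
  classical
  set F := H.filter (fun e => ¬ e ⊆ G) with hF
  have hF3 : ∀ e ∈ F, e.card = 3 := fun e he => hH e (mem_filter.1 he).1
  have hFpos : ∀ e ∈ F, 1 ≤ (e \ G).card := fun e he =>
    card_pos.2 (sdiff_nonempty.2 (mem_filter.1 he).2)
  have hone : ∀ e ∈ F, (e \ G).card = 1 := by
    intro e he
    have h1 := hw {e} (by simpa using he) (by simp [IsMatchingFam])
    rw [sum_singleton] at h1
    have := hFpos e he
    omega
  have hmeet : ∀ e ∈ F, ∀ f ∈ F, e ≠ f → ¬ Disjoint e f := by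
    intro e he f hf hef hd
    have h1 := hw {e, f} (by
      intro k hk
      rcases mem_insert.1 hk with rfl | hk
      · exact he
      · rwa [mem_singleton.1 hk]) (by
      have h0 : IsMatchingFam ({f} : Finset (Finset (Fin n))) := by simp [IsMatchingFam]
      exact h0.insert (by simpa using hd))
    rw [sum_pair hef, hone e he, hone f hf] at h1
    omega
  have hErase : ∀ e ∈ F, ∀ r ∈ e, r ∉ G → e.erase r ⊆ G := by
    intro e he r hre hrG u hu
    obtain ⟨hur, hue⟩ := mem_erase.1 hu
    by_contra huG
    exact hur (card_le_one.1 (hone e he).le u (by simp [hue, huG]) r (by simp [hre, hrG]))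
  by_cases hall : ∀ r ∈ Gᶜ, (F.filter (r ∈ ·)).card ≤ G.card - 1
  · have hsub : F ⊆ Gᶜ.biUnion fun r => F.filter (r ∈ ·) := by
      intro e he
      obtain ⟨r, hre, hrG⟩ := not_subset.1 (mem_filter.1 he).2
      exact mem_biUnion.2 ⟨r, by simpa using hrG, mem_filter.2 ⟨he, hre⟩⟩
    refine (card_le_card hsub).trans ((card_biUnion_le_card_mul _ _ _ hall).trans ?_)
    rw [card_compl, Fintype.card_fin, mul_comm]
  · push Not at hall
    obtain ⟨r, hrG, hrc⟩ := hall
    have hrG' : r ∉ G := by simpa using hrG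
    have hlow : 1000 * (F.filter (r ∈ ·)).card ≤ n ^ 2 := by
      refine le_trans (Nat.mul_le_mul_left _ (card_le_card ?_)) (hr r hrG')
      intro e he
      obtain ⟨heF, hre⟩ := mem_filter.1 he
      exact mem_filter.2 ⟨(mem_filter.1 heF).1, hre, hErase e heF r hre hrG'⟩
    have hthrough : ∀ u ∈ G, ((F.filter (r ∉ ·)).filter (u ∈ ·)).card ≤ 3 * n := by
      intro u hu
      have hur : u ≠ r := fun h => hrG' (h ▸ hu)
      have hex : ∃ e ∈ F.filter (r ∈ ·), u ∉ e := by
        by_contra! hcon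
        have hsub : F.filter (r ∈ ·) ⊆ (G.erase u).image (fun w => {r, u, w}) := by
          intro e he
          have hue := hcon e he
          obtain ⟨heF, hre⟩ := mem_filter.1 he
          have h1 : ((e.erase r).erase u).card = 1 := by
            rw [card_erase_of_mem (mem_erase.2 ⟨hur, hue⟩), card_erase_of_mem hre, hF3 e heF]
          obtain ⟨w, hw'⟩ := card_eq_one.1 h1
          have hwm : w ∈ (e.erase r).erase u := by simp [hw']
          obtain ⟨hwu, hwe⟩ := mem_erase.1 hwm
          refine mem_image.2 ⟨w, mem_erase.2 ⟨hwu, hErase e heF r hre hrG' hwe⟩, ?_⟩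
          rw [← insert_erase hre, ← insert_erase (mem_erase.2 ⟨hur, hue⟩ : u ∈ e.erase r), hw']
        have h2 := (card_le_card hsub).trans card_image_le
        rw [card_erase_of_mem hu] at h2
        omega
      obtain ⟨e, he, hue⟩ := hex
      obtain ⟨heF, hre⟩ := mem_filter.1 he
      rw [← hF3 e heF]
      refine card_le_of_meets hue fun f hf => ?_
      simp only [mem_filter (s := F.filter (r ∉ ·)), mem_filter (s := F)] at hf
      exact ⟨hF3 f hf.1.1, hf.2, hmeet f hf.1.1 e heF fun h => hf.1.2 (h ▸ hre)⟩
    obtain ⟨e, he⟩ : (F.filter (r ∈ ·)).Nonempty := card_pos.1 (by omega)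
    obtain ⟨heF, hre⟩ := mem_filter.1 he
    have hrest : (F.filter (r ∉ ·)).card ≤ 6 * n := by
      have hsub : F.filter (r ∉ ·) ⊆
          (e.erase r).biUnion fun u => (F.filter (r ∉ ·)).filter (u ∈ ·) := by
        intro f hf
        obtain ⟨hfF, hrf⟩ := mem_filter.1 hf
        obtain ⟨u, hue, huf⟩ := not_disjoint_iff.1 (hmeet e heF f hfF fun h => hrf (h ▸ hre))
        exact mem_biUnion.2 ⟨u, mem_erase.2 ⟨fun h => hrf (h ▸ huf), hue⟩,
          mem_filter.2 ⟨hf, huf⟩⟩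
      have h1 := (card_le_card hsub).trans (card_biUnion_le_card_mul _ _ (3 * n) fun u hu =>
        hthrough u (hErase e heF r hre hrG' hu))
      rw [card_erase_of_mem hre, hF3 e heF] at h1
      omega
    have hsplit := card_filter_add_card_filter_not (s := F) (fun e => r ∈ e)
    nlinarith

theorem choose_three_add_le (t i : ℕ) :
    t.choose 3 + i * t.choose 2 ≤ (t + i).choose 3 := by
  induction i with
  | zero => simp
  | succ i ih =>
    have h1 : (t + (i + 1)).choose 3 = (t + i).choose 2 + (t + i).choose 3 :=
      Nat.choose_succ_succ (t + i) 2
    have h2 : t.choose 2 ≤ (t + i).choose 2 := Nat.choose_le_choose 2 (by omega)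
    rw [h1, add_mul]
    omega

theorem choose_two_le_add_card_missing {n : ℕ} (H : Finset (Finset (Fin n)))
    {U : Finset (Fin n)} {x : Fin n} (hx : x ∈ U) :
    (U.card - 1).choose 2 ≤ (H.filter (fun e => x ∈ e ∧ e.erase x ⊆ U)).card +
      ((powersetCard 3 U \ H).filter (x ∈ ·)).card := by
  have hnot : ∀ q ∈ powersetCard 2 (U.erase x), x ∉ q := fun q hq h => by
    simpa using (mem_powersetCard.1 hq).1 h
  have hinj : Set.InjOn (fun q : Finset (Fin n) => insert x q)
      (powersetCard 2 (U.erase x) : Set (Finset (Fin n))) := by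
    intro a ha b hb hab
    have hab' : insert x a = insert x b := hab
    rw [← erase_insert (hnot a ha), hab', erase_insert (hnot b hb)]
  have h1 := card_image_of_injOn hinj
  rw [card_powersetCard, card_erase_of_mem hx] at h1
  rw [← h1]
  refine (card_le_card ?_).trans (card_union_le _ _)
  intro e he
  obtain ⟨q, hq, rfl⟩ := mem_image.1 he
  have hxq := hnot q hq
  obtain ⟨hqs, hq2⟩ := mem_powersetCard.1 hq
  have hqU : q ⊆ U := hqs.trans (erase_subset _ _)
  by_cases hH : insert x q ∈ H
  · refine mem_union_left _ (mem_filter.2 ⟨hH, mem_insert_self _ _, ?_⟩)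
    rwa [erase_insert hxq]
  · refine mem_union_right _ (mem_filter.2 ⟨mem_sdiff.2 ⟨mem_powersetCard.2
      ⟨insert_subset hx hqU, ?_⟩, hH⟩, mem_insert_self _ _⟩)
    rw [card_insert_of_notMem hxq, hq2]

theorem sum_card_filter_mem {n : ℕ} {X : Finset (Finset (Fin n))} (hX : ∀ e ∈ X, e.card = 3) :
    ∑ x : Fin n, (X.filter (x ∈ ·)).card = 3 * X.card := by
  have h := sum_card_bipartiteAbove_eq_sum_card_bipartiteBelow
    (s := (univ : Finset (Fin n))) (t := X) (fun x e => x ∈ e)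
  simp only [bipartiteAbove, bipartiteBelow] at h
  rw [h, sum_congr rfl fun e he => ?_, sum_const, smul_eq_mul, mul_comm]
  rw [← hX e he]
  congr 1
  ext
  simp

theorem mul_sq_le_of_card_bounds {n s t i b : ℕ} (hn : 1000000 ≤ n) (h1 : 5 * n ≤ 18 * s + 18)
    (h2 : 45 * s ≤ 13 * n) (ht : t + b = 3 * s + 2) (hb : 100000 * b ≤ 3 * n) :
    235 * n ^ 2 * (i + 2) ≤
      1000 * ((i + 1) * t.choose 2 + 3 * s * (n - 3 * s - 1)) := by
  have hc := two_mul_choose_two t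
  obtain ⟨d, hd⟩ : ∃ d, n = 3 * s + 1 + d := ⟨n - (3 * s + 1), by omega⟩
  have hd' : n - 3 * s - 1 = d := by omega
  obtain ⟨u, hu⟩ : ∃ u, t = u + 1 := ⟨t - 1, by omega⟩
  rw [hd']
  set c := t.choose 2
  have hc' : 2 * c = (u + 1) * u := by rw [hc, hu]; rfl
  have hu1 : 8332 * n ≤ 10000 * u := by omega
  have hA : 235 * n ^ 2 ≤ 1000 * c := by nlinarith [Nat.mul_le_mul hu1 hu1]
  have hB : 470 * n ^ 2 ≤ 1000 * (c + 3 * s * d) := by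
    have hu2 : 100000 * u + 4 * n ≥ 300000 * s := by omega
    have hx1 : 8332 * n ≤ 10000 * (3 * s) := by omega
    have hx2 : 10000 * (3 * s) ≤ 8668 * n := by omega
    have hq : (3 * s : ℕ) * d + (3 * s) * (3 * s) + 3 * s = 3 * s * n := by
      rw [hd]; ring
    zify at *
    have hu3 : (0 : ℤ) ≤ 100000 * u + 4 * n - 300000 * s := by linarith
    have hsq : (300000 * (s : ℤ) - 4 * n) ^ 2 ≤ (100000 * (u : ℤ)) ^ 2 := by
      apply pow_le_pow_left₀ <;> linarith
    have hk : (0 : ℤ) ≤ (10000 * (3 * s) - 8332 * n) * (8668 * n - 10000 * (3 * s)) :=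
      mul_nonneg (by linarith) (by linarith)
    nlinarith
  nlinarith [Nat.mul_le_mul_left i hA]

/-- Core of the stability theorem with explicit constants. -/
theorem subset_of_almost_clique {n s : ℕ} (hn : 1000000 ≤ n) (h1 : 5 * n ≤ 18 * s + 18)
    (h2 : 45 * s ≤ 13 * n) {H : Finset (Finset (Fin n))} (hH : ∀ e ∈ H, e.card = 3)
    (hν : ∀ M ⊆ H, IsMatchingFam M → M.card ≤ s)
    (hcard : (3 * s + 1).choose 3 + 3 * s * (n - 3 * s - 1) < H.card)
    {U : Finset (Fin n)} (hU : U.card = 3 * s + 2)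
    (hX : 1000000000 * (powersetCard 3 U \ H).card ≤ n ^ 3) :
    ∃ U : Finset (Fin n), U.card = 3 * s + 2 ∧ ∀ e ∈ H, e ⊆ U := by
  classical
  set X := powersetCard 3 U \ H with hXdef
  set A := U.filter (fun x => 10000 * (X.filter (x ∈ ·)).card ≤ n ^ 2) with hAdef
  have hAU : A ⊆ U := filter_subset _ _
  have hA : ∀ x ∈ A, 10000 * (X.filter (x ∈ ·)).card ≤ n ^ 2 := fun x hx => (mem_filter.1 hx).2
  obtain ⟨b, hb⟩ : ∃ b, b = (U \ A).card := ⟨_, rfl⟩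
  have hbn : 100000 * b ≤ 3 * n := by
    have hsum := sum_card_filter_mem (X := X) fun e he =>
      (mem_powersetCard.1 (mem_sdiff.1 he).1).2
    have hle : ∑ x ∈ U \ A, n ^ 2 ≤ ∑ x ∈ U \ A, 10000 * (X.filter (x ∈ ·)).card := by
      refine sum_le_sum fun x hx => ?_
      obtain ⟨hxU, hxA⟩ := mem_sdiff.1 hx
      by_contra! hcon
      exact hxA (mem_filter.2 ⟨hxU, hcon.le⟩)
    have hle2 : ∑ x ∈ U \ A, (X.filter (x ∈ ·)).card ≤
        ∑ x : Fin n, (X.filter (x ∈ ·)).card := sum_le_sum_of_subset (subset_univ _)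
    rw [sum_const, smul_eq_mul, ← mul_sum, ← hb] at hle
    have h3 : (100000 * b) * n ^ 2 ≤ (3 * n) * n ^ 2 := by nlinarith
    exact Nat.le_of_mul_le_mul_right h3 (by positivity)
  have hAc : A.card + b = 3 * s + 2 := by
    rw [hb, ← hU, add_comm]
    exact card_sdiff_add_card_eq_card hAU
  set G := (univ : Finset (Fin n)).filter
    (fun x => n ^ 2 < 2000 * (H.filter (fun e => x ∈ e ∧ e.erase x ⊆ U)).card) with hGdef
  have hG : ∀ x ∈ G, n ^ 2 < 2000 * (H.filter (fun e => x ∈ e ∧ e.erase x ⊆ U)).card :=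
    fun x hx => (mem_filter.1 hx).2
  have hAG : A ⊆ G := by
    intro x hx
    refine mem_filter.2 ⟨mem_univ _, ?_⟩
    have h3 := choose_two_le_add_card_missing H (hAU hx)
    have h4 := hA x hx
    have h5 := two_mul_choose_two (3 * s + 1)
    rw [hU] at h3
    simp only [Nat.add_sub_cancel, show 3 * s + 2 - 1 = 3 * s + 1 by omega] at h3 h5
    have h6 : 8 * n ≤ 10 * (3 * s) := by omega
    have h7 := Nat.mul_le_mul h6 h6
    nlinarith
  have hmatch := exists_matching_of_almost_complete (by omega) hH hAU (by omega) hA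
  have hGc : G.card ≤ 3 * s + 2 := by
    by_contra! hcon
    obtain ⟨P, hAP, hPG, hPc⟩ := exists_subsuperset_card_eq hAG
      (show A.card ≤ 3 * s + 3 by omega) (by omega)
    obtain ⟨M, hMH, hM, -, hMc⟩ := hmatch P (fun x hx => hG x (hPG hx)) (by
      rw [inter_eq_right.2 hAP, ← hb, card_sdiff_of_subset hAP]
      omega)
    have := hν M hMH hM
    omega
  obtain ⟨j, hj⟩ : ∃ j, G.card + j = 3 * s + 2 := ⟨3 * s + 2 - G.card, by omega⟩
  have hAGc := card_le_card hAG
  have hGA : (G \ A).card ≤ b := by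
    rw [card_sdiff_of_subset hAG]
    omega
  have hw : ∀ M ⊆ H.filter (fun e => ¬ e ⊆ G), IsMatchingFam M →
      ∑ e ∈ M, (e \ G).card ≤ j := by
    intro M
    induction M using Finset.induction_on with
    | empty => simp
    | insert e M heM ih =>
      intro hsub hmat
      have hMsub := (subset_insert e M).trans hsub
      have hih := ih hMsub (hmat.mono (subset_insert e M))
      have hMj : M.card ≤ j := by
        refine le_trans ?_ hih
        rw [card_eq_sum_ones]
        exact sum_le_sum fun f hf =>
          card_pos.2 (sdiff_nonempty.2 (mem_filter.1 (hMsub hf)).2)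
      have hNc : (insert e M).card ≤ j + 1 := (card_insert_le _ _).trans (by omega)
      have hNH : insert e M ⊆ H := hsub.trans (filter_subset _ _)
      set N := insert e M
      set T := N.biUnion id with hT
      have hTc : T.card = 3 * N.card := hmat.card_biUnion fun f hf => hH f (hNH hf)
      have hTG : (T \ G).card = ∑ f ∈ N, (f \ G).card := by
        rw [← card_biUnion fun f hf g hg hfg =>
          (hmat hf hg hfg).mono sdiff_subset sdiff_subset]
        congr 1
        ext u
        simp only [hT, mem_sdiff, mem_biUnion, id]
        tauto
      have hcG := card_sdiff_add_card_inter G T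
      have hcT := card_sdiff_add_card_inter T G
      rw [inter_comm] at hcT
      obtain ⟨M', hMH', hM', hMG', hMc'⟩ := hmatch (G \ T)
        (fun x hx => hG x (sdiff_subset hx)) (by
        have h3 : (U \ (G \ T ∩ A)).card ≤ b + T.card := by
          rw [hb]
          refine (card_le_card ?_).trans (card_union_le _ _)
          intro u hu
          simp only [mem_sdiff, mem_inter, mem_union] at hu ⊢
          by_cases huT : u ∈ T
          · exact Or.inr huT
          · exact Or.inl ⟨hu.1, fun huA => hu.2 ⟨⟨hAG huA, huT⟩, huA⟩⟩
        have h4 : ((G \ T) \ A).card ≤ b :=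
          (card_le_card (sdiff_subset_sdiff sdiff_subset le_rfl)).trans hGA
        omega)
      have hdis : ∀ f ∈ N, ∀ g ∈ M', Disjoint f g := fun f hf g hg =>
        (disjoint_sdiff_self_left.mono (hMG' g hg) (subset_biUnion_of_mem id hf)).symm
      have hdisj : Disjoint N M' := by
        rw [disjoint_left]
        intro f hf hf'
        have h0 := disjoint_self.1 (hdis f hf f hf')
        have h3 := hH f (hNH hf)
        rw [h0] at h3
        simp at h3
      have hle := hν (N ∪ M') (union_subset hNH hMH') (hmat.union hM' hdis)
      rw [card_union_of_disjoint hdisj] at hle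
      omega
  have hr : ∀ r ∉ G, 1000 * (H.filter (fun e => r ∈ e ∧ e.erase r ⊆ G)).card ≤ n ^ 2 := by
    intro r hrG
    have h3 : 2000 * (H.filter (fun e => r ∈ e ∧ e.erase r ⊆ U)).card ≤ n ^ 2 := by
      by_contra! hcon
      exact hrG (mem_filter.2 ⟨mem_univ _, hcon⟩)
    have h4 : (H.filter (fun e => r ∈ e ∧ ¬ Disjoint e (G \ U))).card ≤ (G \ U).card * n :=
      card_le_of_meets (fun h => hrG (mem_sdiff.1 h).1) fun e he => by
        obtain ⟨heH, hre, hed⟩ := mem_filter.1 he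
        exact ⟨hH e heH, hre, hed⟩
    have h5 : (G \ U).card ≤ b := (card_le_card (sdiff_subset_sdiff le_rfl hAU)).trans hGA
    have h6 : (H.filter (fun e => r ∈ e ∧ e.erase r ⊆ G)).card ≤
        (H.filter (fun e => r ∈ e ∧ e.erase r ⊆ U)).card +
        (H.filter (fun e => r ∈ e ∧ ¬ Disjoint e (G \ U))).card := by
      refine (card_le_card ?_).trans (card_union_le _ _)
      intro e he
      obtain ⟨heH, hre, heG⟩ := mem_filter.1 he
      by_cases heU : e.erase r ⊆ U
      · exact mem_union_left _ (mem_filter.2 ⟨heH, hre, heU⟩)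
      · obtain ⟨u, hu, huU⟩ := not_subset.1 heU
        exact mem_union_right _ (mem_filter.2 ⟨heH, hre, not_disjoint_iff.2
          ⟨u, mem_of_mem_erase hu, mem_sdiff.2 ⟨heG hu, huU⟩⟩⟩)
    have h7 : (G \ U).card * n ≤ b * n := Nat.mul_le_mul_right n h5
    have h8 : 100000 * b * n ≤ 3 * n * n := Nat.mul_le_mul_right n hbn
    nlinarith
  have hinside : (H.filter (fun e => e ⊆ G)).card ≤ G.card.choose 3 := by
    rw [← card_powersetCard]
    refine card_le_card fun e he => ?_
    obtain ⟨heH, heG⟩ := mem_filter.1 he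
    exact mem_powersetCard.2 ⟨heG, hH e heH⟩
  have hsplit := card_filter_add_card_filter_not (s := H) (fun e => e ⊆ G)
  rcases j with _ | _ | i
  · refine ⟨G, hj, fun e he => ?_⟩
    by_contra hcon
    have h3 := hw {e} (by simpa using ⟨he, hcon⟩) (by simp [IsMatchingFam])
    rw [sum_singleton] at h3
    have := card_pos.2 (sdiff_nonempty.2 hcon)
    omega
  · exfalso
    have hG1 : G.card = 3 * s + 1 := by omega
    have h3 := card_crossing_le_star hH (by
      rw [hG1]
      have h4 : 8 * n ≤ 10 * (3 * s + 1 - 1) := by omega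
      have h5 : n ≤ 10 * (n - (3 * s + 1)) := by omega
      have h6 := Nat.mul_le_mul h4 h5
      nlinarith) hr hw
    rw [hG1, show 3 * s + 1 - 1 = 3 * s by omega, ← Nat.sub_sub] at h3
    rw [hG1] at hinside
    omega
  · exfalso
    have h3 := card_crossing_le (by omega) hH (by omega) hr (j := i + 2) (by omega) hw
    have h4 := mul_sq_le_of_card_bounds (i := i) hn h1 h2 (t := G.card) (b := i + 2) hj (by omega)
    have h5 := choose_three_add_le G.card (i + 1)
    rw [show G.card + (i + 1) = 3 * s + 1 by omega] at h5
    omega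

theorem stability_eps_contains_clique :
    ∃ ε0 : ℝ, 0 < ε0 ∧ ∀ ε : ℝ, 0 < ε → ε < ε0 →
      ∃ n0 : ℕ, 0 < n0 ∧ ∀ n s : ℕ, n0 < n →
        5 * (n : ℝ) / 18 - 1 ≤ (s : ℝ) → (s : ℝ) ≤ 13 * (n : ℝ) / 45 →
        ∀ H ⊆ completeEdges n 3,
          (∀ M ⊆ H, IsMatchingFam M → M.card ≤ s) →
          (3 * s + 1).choose 3 + 3 * s * (n - 3 * s - 1) < H.card →
          (∃ U : Finset (Fin n), U.card = 3 * s + 2 ∧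
            (((Finset.powersetCard 3 U) \ H).card : ℝ) ≤ ε * (n : ℝ) ^ 3) →
          ∃ U : Finset (Fin n), U.card = 3 * s + 2 ∧ ∀ e ∈ H, e ⊆ U := by
  refine ⟨1 / 1000000000, by norm_num, fun ε _ hε => ⟨1000000, by norm_num, ?_⟩⟩
  rintro n s hn h1 h2 H hH hν hcard ⟨U, hU, hX⟩
  refine subset_of_almost_clique hn.le ?_ ?_ (fun e he => (mem_powersetCard.1 (hH he)).2)
    hν hcard hU ?_
  · have : 5 * (n : ℝ) ≤ 18 * s + 18 := by linarith
    exact_mod_cast this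
  · have : 45 * (s : ℝ) ≤ 13 * n := by linarith
    exact_mod_cast this
  · have h3 : ε * (n : ℝ) ^ 3 ≤ 1 / 1000000000 * (n : ℝ) ^ 3 :=
      mul_le_mul_of_nonneg_right hε.le (by positivity)
    have : 1000000000 * ((powersetCard 3 U \ H).card : ℝ) ≤ (n : ℝ) ^ 3 := by linarith
    exact_mod_cast this
end
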